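/- For every integer k ≥ 1 there exist a finite-dimensional complex Lie algebra g, a conjugation σ of g, and a complex Lie subalgebra q of g such that: dim_ℂ q − dim_ℂ(q ∩ σ(q)) = k + 1 (CR dimension k+1); dim_ℂ g − dim_ℂ(q + σ(q)) = 1 (CR codimension 1); q + σ(q) generates g as a Lie algebra (fundamental); and the descending Levi chain satisfies q^(k−1) ≠ q^(k) = q ∩ σ(q), i.e. (g, σ, q) is weakly nondegenerate of Levi order exactly k. -/

import Mathlib

open Pointwise

/-- A conjugation of a complex Lie algebra `g`: an involutive, additive,
conjugate-linear map commuting with the bracket. -/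
structure Conjugation (g : Type*) [LieRing g] [LieAlgebra ℂ g] where
  toFun : g → g
  involutive : ∀ x, toFun (toFun x) = x
  map_add' : ∀ x y, toFun (x + y) = toFun x + toFun y
  map_smul' : ∀ (c : ℂ) (x : g), toFun (c • x) = (starRingEnd ℂ) c • toFun x
  map_bracket' : ∀ x y, toFun ⁅x, y⁆ = ⁅toFun x, toFun y⁆

variable {g : Type*} [LieRing g] [LieAlgebra ℂ g]

/-- The image `σ(q)` of a complex Lie subalgebra under a conjugation, as a
complex linear subspace of `g`. -/
def sigmaSubmodule (σ : Conjugation g) (q : LieSubalgebra ℂ g) : Submodule ℂ g where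
  carrier := σ.toFun '' (q : Set g)
  add_mem' := by
    rintro a b ⟨x, hx, rfl⟩ ⟨y, hy, rfl⟩
    exact ⟨x + y, q.add_mem hx hy, σ.map_add' x y⟩
  zero_mem' := by
    refine ⟨0, q.zero_mem, ?_⟩
    have h := σ.map_smul' 0 0
    simpa using h
  smul_mem' := by
    rintro c a ⟨x, hx, rfl⟩
    refine ⟨(starRingEnd ℂ) c • x, q.smul_mem _ hx, ?_⟩
    rw [σ.map_smul']
    simp

/-- The descending Levi chain of `(g, σ, q)`:
`q⁽⁰⁾ = q` and `q⁽ᵖ⁾ = {Z ∈ q⁽ᵖ⁻¹⁾ : [Z, σ(q)] ⊆ q⁽ᵖ⁻¹⁾ + σ(q)}`. -/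
def leviChain (σ : Conjugation g) (q : LieSubalgebra ℂ g) : ℕ → Set g
  | 0 => (q : Set g)
  | p + 1 =>
      {Z ∈ leviChain σ q p |
        ∀ W ∈ σ.toFun '' (q : Set g), ⁅Z, W⁆ ∈ leviChain σ q p + σ.toFun '' (q : Set g)}

/-- The left shift `(x₀, …, xₙ) ↦ (x₁, …, xₙ, 0)` on `ℂⁿ⁺¹`. -/
def leftShift (n : ℕ) : (Fin (n + 1) → ℂ) →ₗ[ℂ] (Fin (n + 1) → ℂ) where
  toFun x i := if h : (i : ℕ) + 1 < n + 1 then x ⟨i + 1, h⟩ else 0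
  map_add' x y := by
    ext i
    by_cases h : (i : ℕ) < n <;> simp [h]
  map_smul' c x := by
    ext i
    by_cases h : (i : ℕ) < n <;> simp [h]

lemma leftShift_apply (n : ℕ) (x : Fin (n + 1) → ℂ) (i : Fin (n + 1)) :
    leftShift n x i = if h : (i : ℕ) + 1 < n + 1 then x ⟨i + 1, h⟩ else 0 := rfl

lemma leftShift_star (n : ℕ) (x : Fin (n + 1) → ℂ) :
    leftShift n (star x) = star (leftShift n x) := by
  ext i
  by_cases h : (i : ℕ) < n <;> simp [leftShift_apply, h]

/-- The nilpotent Lie algebra spanned by `e`, `f`, `v₋ₙ₋₁, …, vₙ₊₁` whose nonzero brackets are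
`[f, vᵢ] = vᵢ₋₁` and `[e, v₋ᵢ] = v₋ᵢ₊₁` for `i > 0`. The element `(a, b, x, y, t)` stands for
`a e + b f + ∑ xᵢ vᵢ₊₁ + ∑ yᵢ v₋ᵢ₋₁ + t v₀`. -/
def TwoChain (n : ℕ) : Type := ℂ × ℂ × (Fin (n + 1) → ℂ) × (Fin (n + 1) → ℂ) × ℂ

namespace TwoChain

variable {n : ℕ}

instance : AddCommGroup (TwoChain n) :=
  inferInstanceAs (AddCommGroup (ℂ × ℂ × (Fin (n + 1) → ℂ) × (Fin (n + 1) → ℂ) × ℂ))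

instance : Module ℂ (TwoChain n) :=
  inferInstanceAs (Module ℂ (ℂ × ℂ × (Fin (n + 1) → ℂ) × (Fin (n + 1) → ℂ) × ℂ))

instance : FiniteDimensional ℂ (TwoChain n) :=
  inferInstanceAs (FiniteDimensional ℂ (ℂ × ℂ × (Fin (n + 1) → ℂ) × (Fin (n + 1) → ℂ) × ℂ))

/-- The coefficient of `e`. -/
def a (z : TwoChain n) : ℂ := z.1
/-- The coefficient of `f`. -/
def b (z : TwoChain n) : ℂ := z.2.1
/-- The coefficients of `v₁, …, vₙ₊₁`. -/
def x (z : TwoChain n) : Fin (n + 1) → ℂ := z.2.2.1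
/-- The coefficients of `v₋₁, …, v₋ₙ₋₁`. -/
def y (z : TwoChain n) : Fin (n + 1) → ℂ := z.2.2.2.1
/-- The coefficient of `v₀`. -/
def t (z : TwoChain n) : ℂ := z.2.2.2.2

/-- The element with the given coefficients. -/
def mk (a b : ℂ) (x y : Fin (n + 1) → ℂ) (t : ℂ) : TwoChain n := (a, b, x, y, t)

@[ext] lemma ext {z w : TwoChain n} (ha : z.a = w.a) (hb : z.b = w.b) (hx : z.x = w.x)
    (hy : z.y = w.y) (ht : z.t = w.t) : z = w :=
  Prod.ext ha (Prod.ext hb (Prod.ext hx (Prod.ext hy ht)))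

section Coefficients

variable (a₀ b₀ t₀ c : ℂ) (x₀ y₀ : Fin (n + 1) → ℂ) (z w : TwoChain n)

@[simp] lemma a_mk : (mk a₀ b₀ x₀ y₀ t₀).a = a₀ := rfl
@[simp] lemma b_mk : (mk a₀ b₀ x₀ y₀ t₀).b = b₀ := rfl
@[simp] lemma x_mk : (mk a₀ b₀ x₀ y₀ t₀).x = x₀ := rfl
@[simp] lemma y_mk : (mk a₀ b₀ x₀ y₀ t₀).y = y₀ := rfl
@[simp] lemma t_mk : (mk a₀ b₀ x₀ y₀ t₀).t = t₀ := rfl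
@[simp] lemma a_zero : (0 : TwoChain n).a = 0 := rfl
@[simp] lemma b_zero : (0 : TwoChain n).b = 0 := rfl
@[simp] lemma x_zero : (0 : TwoChain n).x = 0 := rfl
@[simp] lemma y_zero : (0 : TwoChain n).y = 0 := rfl
@[simp] lemma t_zero : (0 : TwoChain n).t = 0 := rfl
@[simp] lemma a_add : (z + w).a = z.a + w.a := rfl
@[simp] lemma b_add : (z + w).b = z.b + w.b := rfl
@[simp] lemma x_add : (z + w).x = z.x + w.x := rfl
@[simp] lemma y_add : (z + w).y = z.y + w.y := rfl
@[simp] lemma t_add : (z + w).t = z.t + w.t := rfl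
@[simp] lemma a_smul : (c • z).a = c * z.a := rfl
@[simp] lemma b_smul : (c • z).b = c * z.b := rfl
@[simp] lemma x_smul : (c • z).x = c • z.x := rfl
@[simp] lemma y_smul : (c • z).y = c • z.y := rfl
@[simp] lemma t_smul : (c • z).t = c * z.t := rfl

end Coefficients

instance : Bracket (TwoChain n) (TwoChain n) where
  bracket z w := mk 0 0 (z.b • leftShift n w.x - w.b • leftShift n z.x)
    (z.a • leftShift n w.y - w.a • leftShift n z.y)
    (z.b * w.x 0 - w.b * z.x 0 + (z.a * w.y 0 - w.a * z.y 0))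

lemma bracket_def (z w : TwoChain n) :
    ⁅z, w⁆ = mk 0 0 (z.b • leftShift n w.x - w.b • leftShift n z.x)
      (z.a • leftShift n w.y - w.a • leftShift n z.y)
      (z.b * w.x 0 - w.b * z.x 0 + (z.a * w.y 0 - w.a * z.y 0)) := rfl

instance : LieRing (TwoChain n) where
  add_lie z w u := by
    ext <;> simp [bracket_def] <;> ring
  lie_add z w u := by
    ext <;> simp [bracket_def] <;> ring
  lie_self z := by
    ext <;> simp [bracket_def]
  leibniz_lie z w u := by
    ext <;> simp [bracket_def] <;> ring

instance : LieAlgebra ℂ (TwoChain n) where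
  lie_smul c z w := by
    ext <;> simp [bracket_def] <;> ring

/-- The conjugation exchanging `e` with `f` and `vᵢ` with `v₋ᵢ`. -/
def conj (n : ℕ) : Conjugation (TwoChain n) where
  toFun z := mk (star z.b) (star z.a) (star z.y) (star z.x) (star z.t)
  involutive z := by ext <;> simp
  map_add' z w := by ext <;> simp
  map_smul' c z := by ext <;> simp
  map_bracket' z w := by
    ext <;> simp [bracket_def, leftShift_star]
    ring

/-- The abelian subalgebra spanned by `e` and the `vᵢ` with `i > 0`. -/
def posPart (n : ℕ) : LieSubalgebra ℂ (TwoChain n) where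
  carrier := {z | z.b = 0 ∧ z.y = 0 ∧ z.t = 0}
  add_mem' := by
    rintro z w ⟨h1, h2, h3⟩ ⟨h4, h5, h6⟩
    simp [*]
  zero_mem' := by simp
  smul_mem' := by
    rintro c z ⟨h1, h2, h3⟩
    simp [*]
  lie_mem' := by
    rintro z w ⟨h1, h2, h3⟩ ⟨h4, h5, h6⟩
    simp [bracket_def, *]

lemma mem_posPart {z : TwoChain n} : z ∈ posPart n ↔ z.b = 0 ∧ z.y = 0 ∧ z.t = 0 := Iff.rfl

lemma mem_conj_image_posPart {z : TwoChain n} :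
    z ∈ (conj n).toFun '' (posPart n : Set (TwoChain n)) ↔ z.a = 0 ∧ z.x = 0 ∧ z.t = 0 := by
  constructor
  · rintro ⟨w, ⟨h1, h2, h3⟩, rfl⟩
    simp [conj, *]
  · rintro ⟨h1, h2, h3⟩
    refine ⟨(conj n).toFun z, ?_, (conj n).involutive z⟩
    simp [mem_posPart, conj, *]

lemma mem_leviChain_posPart (p : ℕ) {z : TwoChain n} :
    z ∈ leviChain (conj n) (posPart n) p ↔
      z ∈ posPart n ∧ (0 < p → z.a = 0) ∧ ∀ i : Fin (n + 1), (i : ℕ) < p → z.x i = 0 := by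
  induction p generalizing z with
  | zero => simp [leviChain]
  | succ p ih =>
    have mem_add (u : TwoChain n) :
        u ∈ leviChain (conj n) (posPart n) p + (conj n).toFun '' (posPart n : Set (TwoChain n)) ↔
          u.t = 0 ∧ (0 < p → u.a = 0) ∧ ∀ i : Fin (n + 1), (i : ℕ) < p → u.x i = 0 := by
      rw [Set.mem_add]
      constructor
      · rintro ⟨v, hv, w, hw, rfl⟩
        rw [ih, mem_posPart] at hv
        rw [mem_conj_image_posPart] at hw
        obtain ⟨⟨-, -, h1⟩, h2, h3⟩ := hv
        obtain ⟨h4, h5, h6⟩ := hw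
        refine ⟨by simp [*], fun h => by simp [h2 h, h4], fun i hi => by simp [h3 i hi, h5]⟩
      · rintro ⟨h1, h2, h3⟩
        refine ⟨mk u.a 0 u.x 0 0, ih.2 ⟨by simp [mem_posPart], h2, h3⟩, mk 0 u.b 0 u.y 0,
          mem_conj_image_posPart.2 (by simp), ?_⟩
        ext <;> simp [h1]
    change (z ∈ leviChain (conj n) (posPart n) p ∧ _) ↔ _
    simp only [mem_add, ih]
    constructor
    · rintro ⟨⟨hz, ha, hx⟩, H⟩
      obtain ⟨h0, -, hs⟩ := H (mk 0 1 0 0 0) (mem_conj_image_posPart.2 (by simp))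
      obtain ⟨h1, -, -⟩ := H (mk 0 0 0 (Pi.single 0 1) 0) (mem_conj_image_posPart.2 (by simp))
      refine ⟨hz, fun _ => by simpa [bracket_def] using h1, fun i hi => ?_⟩
      induction i using Fin.cases with
      | zero => simpa [bracket_def] using h0
      | succ j =>
        have := hs j.castSucc (by simpa using hi)
        simpa [bracket_def, leftShift_apply, Fin.succ] using this
    · rintro ⟨hz, ha, hx⟩
      have ha0 : z.a = 0 := ha p.succ_pos
      refine ⟨⟨hz, fun _ => ha0, fun i hi => hx i (by omega)⟩, fun w hw => ?_⟩
      obtain ⟨h1, h2, h3⟩ := mem_conj_image_posPart.1 hw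
      have hx0 : z.x 0 = 0 := hx 0 (by simp)
      refine ⟨by simp [bracket_def, h1, h2, ha0, hx0], by simp [bracket_def], fun i hi => ?_⟩
      by_cases h : (i : ℕ) < n
      · simp [bracket_def, leftShift_apply, h, h2, hx ⟨i + 1, by omega⟩ (by simpa using hi)]
      · simp [bracket_def, leftShift_apply, h]

lemma finrank_eq (n : ℕ) : Module.finrank ℂ (TwoChain n) = 2 * n + 5 := by
  change Module.finrank ℂ (ℂ × ℂ × (Fin (n + 1) → ℂ) × (Fin (n + 1) → ℂ) × ℂ) = _
  simp
  ring

/-- The linear parametrization of `posPart n` by coefficients. -/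
def posEmb (n : ℕ) : (ℂ × (Fin (n + 1) → ℂ)) →ₗ[ℂ] TwoChain n where
  toFun u := mk u.1 0 u.2 0 0
  map_add' u v := by ext <;> simp
  map_smul' c u := by ext <;> simp

/-- The linear parametrization of the conjugate of `posPart n` by coefficients. -/
def negEmb (n : ℕ) : (ℂ × (Fin (n + 1) → ℂ)) →ₗ[ℂ] TwoChain n where
  toFun u := mk 0 u.1 0 u.2 0
  map_add' u v := by ext <;> simp
  map_smul' c u := by ext <;> simp

lemma finrank_posPart (n : ℕ) : Module.finrank ℂ (posPart n).toSubmodule = n + 2 := by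
  have h : (posPart n).toSubmodule = LinearMap.range (posEmb n) := by
    ext z
    constructor
    · rintro ⟨h1, h2, h3⟩
      exact ⟨(z.a, z.x), by ext <;> simp [posEmb, *]⟩
    · rintro ⟨u, rfl⟩
      exact ⟨rfl, rfl, rfl⟩
  rw [h, LinearMap.finrank_range_of_inj]
  · simp
    ring
  · intro u v huv
    exact Prod.ext (congrArg a huv) (congrArg x huv)

lemma finrank_sigmaSubmodule_posPart (n : ℕ) :
    Module.finrank ℂ (sigmaSubmodule (conj n) (posPart n)) = n + 2 := by
  have h : sigmaSubmodule (conj n) (posPart n) = LinearMap.range (negEmb n) := by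
    ext z
    refine mem_conj_image_posPart.trans ⟨?_, ?_⟩
    · rintro ⟨h1, h2, h3⟩
      exact ⟨(z.b, z.y), by ext <;> simp [negEmb, *]⟩
    · rintro ⟨u, rfl⟩
      exact ⟨rfl, rfl, rfl⟩
  rw [h, LinearMap.finrank_range_of_inj]
  · simp
    ring
  · intro u v huv
    exact Prod.ext (congrArg b huv) (congrArg y huv)

lemma posPart_inf_sigmaSubmodule (n : ℕ) :
    (posPart n).toSubmodule ⊓ sigmaSubmodule (conj n) (posPart n) = ⊥ := by
  refine (Submodule.eq_bot_iff _).2 ?_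
  rintro z ⟨⟨h1, h2, h3⟩, hz⟩
  obtain ⟨h4, h5, -⟩ := mem_conj_image_posPart.1 hz
  ext <;> simp [*]

lemma finrank_posPart_sup_sigmaSubmodule (n : ℕ) :
    Module.finrank ℂ
      ((posPart n).toSubmodule ⊔ sigmaSubmodule (conj n) (posPart n) : Submodule ℂ (TwoChain n)) =
        2 * n + 4 := by
  have h := Submodule.finrank_sup_add_finrank_inf_eq (posPart n).toSubmodule
    (sigmaSubmodule (conj n) (posPart n))
  rw [posPart_inf_sigmaSubmodule, finrank_bot, finrank_posPart,
    finrank_sigmaSubmodule_posPart] at h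
  omega

lemma lieSpan_posPart_add_conj (n : ℕ) :
    LieSubalgebra.lieSpan ℂ (TwoChain n)
      ((posPart n : Set (TwoChain n)) + (conj n).toFun '' (posPart n : Set (TwoChain n))) = ⊤ := by
  rw [eq_top_iff]
  rintro z -
  set L := LieSubalgebra.lieSpan ℂ (TwoChain n)
    ((posPart n : Set (TwoChain n)) + (conj n).toFun '' (posPart n : Set (TwoChain n)))
  have mem_of_t {u : TwoChain n} (hu : u.t = 0) : u ∈ L := by
    refine LieSubalgebra.subset_lieSpan (Set.mem_add.2 ⟨mk u.a 0 u.x 0 0,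
      mem_posPart.2 (by simp), mk 0 u.b 0 u.y 0, mem_conj_image_posPart.2 (by simp), ?_⟩)
    ext <;> simp [hu]
  have hv : ⁅(mk 0 1 0 0 0 : TwoChain n), mk 0 0 (Pi.single 0 1) 0 0⁆ ∈ L :=
    L.lie_mem (mem_of_t rfl) (mem_of_t rfl)
  have hz : z = mk z.a z.b z.x z.y 0 +
      z.t • ⁅(mk 0 1 0 0 0 : TwoChain n), mk 0 0 (Pi.single 0 1) 0 0⁆ := by
    have hs : leftShift n (Pi.single 0 1) = 0 := by
      ext i
      rw [leftShift_apply]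
      split_ifs with h
      · exact Pi.single_eq_of_ne (Fin.ne_of_val_ne i.val.succ_ne_zero) 1
      · rfl
    ext <;> simp [bracket_def, hs]
  rw [hz]
  exact L.add_mem (mem_of_t rfl) (L.smul_mem _ hv)

end TwoChain

/-- For every integer `k ≥ 1` there is a finite-dimensional complex Lie algebra with a
conjugation and a complex Lie subalgebra giving a fundamental `CR` algebra of `CR`
dimension `k + 1`, `CR` codimension `1`, which is weakly nondegenerate of Levi order
exactly `k`. -/
theorem exists_weaklyNondegenerate_of_leviOrder (k : ℕ) (hk : 1 ≤ k) :
    ∃ (g : Type) (_ : LieRing g) (_ : LieAlgebra ℂ g) (_ : FiniteDimensional ℂ g)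
      (σ : Conjugation g) (q : LieSubalgebra ℂ g),
      Module.finrank ℂ q.toSubmodule -
          Module.finrank ℂ (q.toSubmodule ⊓ sigmaSubmodule σ q : Submodule ℂ g) = k + 1 ∧
      Module.finrank ℂ g -
          Module.finrank ℂ (q.toSubmodule ⊔ sigmaSubmodule σ q : Submodule ℂ g) = 1 ∧
      LieSubalgebra.lieSpan ℂ g ((q : Set g) + σ.toFun '' (q : Set g)) = ⊤ ∧
      leviChain σ q (k - 1) ≠ leviChain σ q k ∧
      leviChain σ q k = (q : Set g) ∩ σ.toFun '' (q : Set g) := by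
  obtain ⟨n, rfl⟩ : ∃ n, k = n + 1 := ⟨k - 1, by omega⟩
  refine ⟨TwoChain n, inferInstance, inferInstance, inferInstance, TwoChain.conj n,
    TwoChain.posPart n, ?_, ?_, TwoChain.lieSpan_posPart_add_conj n, ?_, ?_⟩
  · rw [TwoChain.posPart_inf_sigmaSubmodule, TwoChain.finrank_posPart, finrank_bot]
    omega
  · have h1 := TwoChain.finrank_eq n
    have h2 := TwoChain.finrank_posPart_sup_sigmaSubmodule n
    omega
  · intro h
    have hmem : TwoChain.mk 0 0 (Pi.single (Fin.last n) 1) 0 0 ∈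
        leviChain (TwoChain.conj n) (TwoChain.posPart n) (n + 1 - 1) := by
      refine (TwoChain.mem_leviChain_posPart _).2
        ⟨TwoChain.mem_posPart.2 (by simp), fun _ => rfl, fun i hi => ?_⟩
      have hne : i ≠ Fin.last n := by
        rintro rfl
        simp at hi
      simp [hne]
    rw [h, TwoChain.mem_leviChain_posPart] at hmem
    simpa using hmem.2.2 (Fin.last n) (by simp)
  · ext z
    rw [TwoChain.mem_leviChain_posPart, Set.mem_inter_iff, TwoChain.mem_conj_image_posPart]
    refine and_congr_right fun hz => ⟨fun ⟨h1, h2⟩ => ?_, fun ⟨h1, h2, _⟩ => ?_⟩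
    · exact ⟨h1 n.succ_pos, funext fun i => h2 i i.isLt, hz.2.2⟩
    · exact ⟨fun _ => h1, fun i _ => congrFun h2 i⟩
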